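/- There are exactly 10 unordered pairs {v₁+M, v₂+M} of distinct cosets of order 2 in M^∨/M such that each vᵢ can be chosen with B(vᵢ,vᵢ) = 1/2 and such that v₂ + M = τ(v₁) + M. -/

import Mathlib

open Matrix

noncomputable section

/-- Gram matrix of the even lattice `2U(2) ⊕ 2A₁`. -/
def GramC : Matrix (Fin 6) (Fin 6) ℚ :=
  !![0,0,0,0,0,2; 0,0,0,0,2,0; 0,0,2,0,0,0; 0,0,0,2,0,0; 0,2,0,0,0,0; 2,0,0,0,0,0]

/-- The bilinear form on `V = ℚ⁶` with Gram matrix `GramC`. -/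
def BC (x y : Fin 6 → ℚ) : ℚ := x ⬝ᵥ GramC.mulVec y

/-- The lattice `M = ℤ⁶ ⊆ ℚ⁶`. -/
def MC : AddSubgroup (Fin 6 → ℚ) where
  carrier := {x | ∀ i, ∃ n : ℤ, x i = (n : ℚ)}
  zero_mem' := fun i => ⟨0, by simp⟩
  add_mem' := by
    intro a b ha hb i
    obtain ⟨n, hn⟩ := ha i
    obtain ⟨m, hm⟩ := hb i
    exact ⟨n + m, by simp [hn, hm]⟩
  neg_mem' := by
    intro a ha i
    obtain ⟨n, hn⟩ := ha i
    exact ⟨-n, by simp [hn]⟩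

/-- The dual lattice `M^∨ = {x ∈ V : B(x,m) ∈ ℤ for all m ∈ M}`. -/
def MCdual : Set (Fin 6 → ℚ) := {x | ∀ m ∈ MC, ∃ n : ℤ, BC x m = (n : ℚ)}

/-- The quotient `V/M` (containing the discriminant group `M^∨/M`). -/
abbrev QC := (Fin 6 → ℚ) ⧸ MC

/-- The projection `V → V/M`. -/
def pC : (Fin 6 → ℚ) → QC := QuotientAddGroup.mk

/-- The isometry `τ` swapping the two `A₁` components (the 3rd and 4th standard
coordinates). -/
def tauC (x : Fin 6 → ℚ) : Fin 6 → ℚ := fun i => x (Equiv.swap (2 : Fin 6) 3 i)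

/-- The vector with doubled coordinates `a, b, 1, 0, c, d`. -/
def rC (q : ℤ × ℤ × ℤ × ℤ) : Fin 6 → ℚ :=
  ![(q.1 : ℚ) / 2, (q.2.1 : ℚ) / 2, 1 / 2, 0, (q.2.2.1 : ℚ) / 2, (q.2.2.2 : ℚ) / 2]

/-- Index set of the pairs. -/
def SC : Finset (ℤ × ℤ × ℤ × ℤ) :=
  ((({0, 1} : Finset ℤ) ×ˢ ({0, 1} : Finset ℤ) ×ˢ ({0, 1} : Finset ℤ) ×ˢ
    ({0, 1} : Finset ℤ))).filter (fun q => (q.1 * q.2.2.2 + q.2.1 * q.2.2.1) % 2 = 0)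

/-- The pair of an index. -/
def gC (q : ℤ × ℤ × ℤ × ℤ) : Sym2 QC := s(pC (rC q), pC (tauC (rC q)))

theorem SC_card : SC.card = 10 := by decide

theorem mem_SC (q : ℤ × ℤ × ℤ × ℤ) : q ∈ SC ↔
    ((q.1 = 0 ∨ q.1 = 1) ∧ (q.2.1 = 0 ∨ q.2.1 = 1) ∧ (q.2.2.1 = 0 ∨ q.2.2.1 = 1) ∧
      (q.2.2.2 = 0 ∨ q.2.2.2 = 1)) ∧ (q.1 * q.2.2.2 + q.2.1 * q.2.2.1) % 2 = 0 := by
  simp [SC]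

theorem pC_eq (x y : Fin 6 → ℚ) : pC x = pC y ↔ ∀ i, ∃ n : ℤ, y i - x i = n := by
  unfold pC
  rw [QuotientAddGroup.eq]
  change (∀ i, ∃ n : ℤ, (-x + y) i = n) ↔ _
  simp only [Pi.add_apply, Pi.neg_apply, neg_add_eq_sub]

theorem BC_apply (x y : Fin 6 → ℚ) : BC x y =
    2 * (x 0 * y 5 + x 1 * y 4 + x 2 * y 2 + x 3 * y 3 + x 4 * y 1 + x 5 * y 0) := by
  simp [BC, GramC, dotProduct, mulVec, Fin.sum_univ_succ]
  ring

theorem tau0 (x : Fin 6 → ℚ) : tauC x 0 = x 0 := rfl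
theorem tau1 (x : Fin 6 → ℚ) : tauC x 1 = x 1 := rfl
theorem tau2 (x : Fin 6 → ℚ) : tauC x 2 = x 3 := rfl
theorem tau3 (x : Fin 6 → ℚ) : tauC x 3 = x 2 := rfl
theorem tau4 (x : Fin 6 → ℚ) : tauC x 4 = x 4 := rfl
theorem tau5 (x : Fin 6 → ℚ) : tauC x 5 = x 5 := rfl

theorem forall6 (P : Fin 6 → Prop) : (∀ i, P i) ↔ P 0 ∧ P 1 ∧ P 2 ∧ P 3 ∧ P 4 ∧ P 5 := by
  constructor
  · intro h
    exact ⟨h 0, h 1, h 2, h 3, h 4, h 5⟩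
  · rintro ⟨h0, h1, h2, h3, h4, h5⟩ i
    fin_cases i <;> assumption

theorem half_int (a b : ℤ) : (∃ n : ℤ, (b : ℚ) / 2 - (a : ℚ) / 2 = n) ↔ a % 2 = b % 2 := by
  constructor
  · rintro ⟨n, hn⟩
    have h : (b : ℚ) - a = 2 * n := by linarith
    have h' : b - a = 2 * n := by exact_mod_cast h
    omega
  · intro h
    refine ⟨(b - a) / 2, ?_⟩
    have h' : b - a = 2 * ((b - a) / 2) := by omega
    have h'' : (b : ℚ) - a = 2 * (((b - a) / 2 : ℤ) : ℚ) := by exact_mod_cast h'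
    linarith

/-- Half of an integer vector. -/
def hC (a : Fin 6 → ℤ) : Fin 6 → ℚ := fun i => (a i : ℚ) / 2

theorem pC_hC (a b : Fin 6 → ℤ) : pC (hC a) = pC (hC b) ↔ ∀ i, a i % 2 = b i % 2 := by
  rw [pC_eq]
  exact forall_congr' fun i => half_int (a i) (b i)

theorem rC_eq (q : ℤ × ℤ × ℤ × ℤ) : rC q = hC ![q.1, q.2.1, 1, 0, q.2.2.1, q.2.2.2] := by
  funext i
  fin_cases i <;> simp [rC, hC]

theorem tau_hC (a : Fin 6 → ℤ) : tauC (hC a) = hC ![a 0, a 1, a 3, a 2, a 4, a 5] := by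
  funext i
  fin_cases i <;> rfl

theorem hC_dual (a : Fin 6 → ℤ) : hC a ∈ MCdual := by
  intro m hm
  choose n hn using hm
  refine ⟨a 0 * n 5 + a 1 * n 4 + a 2 * n 2 + a 3 * n 3 + a 4 * n 1 + a 5 * n 0, ?_⟩
  rw [BC_apply]
  simp only [hn, hC]
  push_cast
  ring

theorem dual_hC (v : Fin 6 → ℚ) (hv : v ∈ MCdual) : ∃ a, v = hC a := by
  have key : ∀ j, ∃ n : ℤ, BC v (Pi.single j 1) = n := fun j => hv _ (fun i => by
    by_cases h : i = j
    · subst h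
      exact ⟨1, by simp⟩
    · exact ⟨0, by simp [h]⟩)
  simp only [BC_apply] at key
  have h : ∀ i, ∃ n : ℤ, v i = (n : ℚ) / 2 := by
    rw [forall6] at key ⊢
    obtain ⟨⟨n0, h0⟩, ⟨n1, h1⟩, ⟨n2, h2⟩, ⟨n3, h3⟩, ⟨n4, h4⟩, ⟨n5, h5⟩⟩ := key
    simp at h0 h1 h2 h3 h4 h5
    exact ⟨⟨n5, by linarith⟩, ⟨n4, by linarith⟩, ⟨n2, by linarith⟩, ⟨n3, by linarith⟩,
      ⟨n1, by linarith⟩, ⟨n0, by linarith⟩⟩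
  choose a ha using h
  exact ⟨a, funext ha⟩

theorem order_hC (a : Fin 6 → ℤ) (i : Fin 6) (hi : a i % 2 = 1) : addOrderOf (pC (hC a)) = 2 := by
  apply addOrderOf_eq_prime
  · change (2 : ℕ) • (QuotientAddGroup.mk (hC a) : QC) = 0
    rw [← QuotientAddGroup.mk_nsmul, QuotientAddGroup.eq_zero_iff]
    intro j
    exact ⟨a j, by simp [hC]; ring⟩
  · intro h
    have h0 : pC (hC a) = pC (hC 0) := by
      rw [h]
      have : hC 0 = 0 := by funext j; simp [hC]
      rw [this]
      rfl
    rw [pC_hC] at h0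
    have := h0 i
    simp at this
    omega

theorem BC_hC (a : Fin 6 → ℤ) : BC (hC a) (hC a) = 1 / 2 ↔
    2 * (a 0 * a 5 + a 1 * a 4) + a 2 * a 2 + a 3 * a 3 = 1 := by
  rw [BC_apply]
  simp only [hC]
  rw [← @Int.cast_inj ℚ]
  push_cast
  constructor <;> intro h <;> linarith

theorem gC_inj : Set.InjOn gC (SC : Set (ℤ × ℤ × ℤ × ℤ)) := by
  rintro ⟨a, b, c, d⟩ h ⟨a', b', c', d'⟩ h' he
  rw [Finset.mem_coe, mem_SC] at h h'
  simp only [gC, rC_eq, tau_hC, Sym2.eq_iff, pC_hC, forall6] at he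
  simp at he h h'
  simp only [Prod.mk.injEq]
  omega

theorem set_eq : {P : Sym2 QC | ∃ v₁ v₂ : Fin 6 → ℚ, v₁ ∈ MCdual ∧ v₂ ∈ MCdual ∧
      pC v₁ ≠ pC v₂ ∧ addOrderOf (pC v₁) = 2 ∧ addOrderOf (pC v₂) = 2 ∧
      BC v₁ v₁ = 1/2 ∧ BC v₂ v₂ = 1/2 ∧ pC v₂ = pC (tauC v₁) ∧
      P = s(pC v₁, pC v₂)} = gC '' (SC : Set (ℤ × ℤ × ℤ × ℤ)) := by
  ext P
  constructor
  · rintro ⟨v, w, hv, -, hne, -, -, hB, -, hw, rfl⟩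
    rw [hw] at hne ⊢
    obtain ⟨a, rfl⟩ := dual_hC v hv
    rw [BC_hC] at hB
    refine ⟨(a 0 % 2, a 1 % 2, a 4 % 2, a 5 % 2), ?_, ?_⟩
    · rw [Finset.mem_coe, mem_SC]
      have hpar : a 2 % 2 ≠ a 3 % 2 := by
        intro h
        apply hne
        rw [tau_hC, pC_hC, forall6]
        simp [h]
      refine ⟨by simp only; omega, ?_⟩
      have e : (a 0 % 2 * (a 5 % 2) + a 1 % 2 * (a 4 % 2)) % 2 = (a 0 * a 5 + a 1 * a 4) % 2 := by
        simp [Int.add_emod, Int.mul_emod]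
      simp only
      rw [e]
      have sq : ∀ x : ℤ, (x % 2 = 0 ∧ x * x % 4 = 0) ∨ (x % 2 = 1 ∧ x * x % 4 = 1) := by
        intro x
        have h4 : x % 4 = 0 ∨ x % 4 = 1 ∨ x % 4 = 2 ∨ x % 4 = 3 := by omega
        rcases h4 with h | h | h | h <;> simp [Int.mul_emod, h] <;> omega
      have s2 := sq (a 2)
      have s3 := sq (a 3)
      generalize a 2 * a 2 = y at *
      generalize a 3 * a 3 = z at *
      omega
    · have hpar : a 2 % 2 ≠ a 3 % 2 := by
        intro h
        apply hne
        rw [tau_hC, pC_hC, forall6]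
        simp [h]
      simp only [gC, rC_eq, tau_hC, Sym2.eq_iff, pC_hC, forall6]
      simp
      omega
  · rintro ⟨⟨a, b, c, d⟩, h, rfl⟩
    rw [Finset.mem_coe, mem_SC] at h
    simp only at h
    obtain ⟨e, he, hB⟩ : ∃ e : ℤ, e % 2 = d % 2 ∧ a * e + b * c = 0 := by
      obtain ⟨⟨rfl | rfl, rfl | rfl, rfl | rfl, rfl | rfl⟩, h⟩ := h <;> first
        | (refine ⟨0, ?_, ?_⟩ <;> norm_num <;> done)
        | (refine ⟨1, ?_, ?_⟩ <;> norm_num <;> done)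
        | (refine ⟨-1, ?_, ?_⟩ <;> norm_num <;> done)
        | (exfalso; omega)
    refine ⟨hC ![a, b, 1, 0, c, e], hC ![a, b, 0, 1, c, e], hC_dual _, hC_dual _, ?_,
      order_hC _ 2 (by simp), order_hC _ 3 (by simp), ?_, ?_, ?_, ?_⟩
    · rw [Ne, pC_hC, forall6]
      simp
    · rw [BC_hC]
      simp [hB]
    · rw [BC_hC]
      simp [hB]
    · rw [tau_hC]
      rfl
    · simp only [gC, rC_eq, tau_hC, Sym2.eq_iff, pC_hC, forall6]
      simp [he]

/-- There are exactly 10 unordered pairs `{v₁+M, v₂+M}` of distinct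
cosets of order 2 in `M^∨/M` such that each `vᵢ` can be chosen with `B(vᵢ,vᵢ) = 1/2`
and such that `v₂ + M = τ(v₁) + M`. -/
theorem statement15 :
    {P : Sym2 QC | ∃ v₁ v₂ : Fin 6 → ℚ, v₁ ∈ MCdual ∧ v₂ ∈ MCdual ∧
      pC v₁ ≠ pC v₂ ∧ addOrderOf (pC v₁) = 2 ∧ addOrderOf (pC v₂) = 2 ∧
      BC v₁ v₁ = 1/2 ∧ BC v₂ v₂ = 1/2 ∧ pC v₂ = pC (tauC v₁) ∧
      P = s(pC v₁, pC v₂)}.ncard = 10 := by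
  rw [set_eq, Set.InjOn.ncard_image gC_inj, Set.ncard_coe_finset, SC_card]

end
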